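/- Let a, γ, x be nonzero complex numbers with (a;q)_n ≠ 0 for all n ≥ 0. Then the big q-Bessel function satisfies the second-order q-difference equation (1/x)·(1 + 1/(a·x))·(J_γ(q·x;a;q) − J_γ(x;a;q)) + (q/(a·x))·(1 + 1/x)·(J_γ(q⁻¹·x;a;q) − J_γ(x;a;q)) = −γ·J_γ(x;a;q). -/

import Mathlib

/-- The q-shifted factorial `(a;q)_n = ∏_{j=0}^{n-1} (1 - a q^j)`. -/
noncomputable def qPoch (a q : ℂ) (n : ℕ) : ℂ := ∏ j ∈ Finset.range n, (1 - a * q ^ j)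

/-- The big q-Bessel function
`J_γ(x;a;q) = ∑ (-1/x;q)_n (-1)^n q^{n(n-1)/2} / ((a;q)_n (q;q)_n) (aγx)^n`. -/
noncomputable def bigQBessel (q a γ x : ℂ) : ℂ :=
  ∑' n : ℕ, qPoch (-1 / x) q n * (-1) ^ n * q ^ (n * (n - 1) / 2) /
    (qPoch a q n * qPoch q q n) * (a * γ * x) ^ n

open Filter Topology

/-- The coefficient of `∏_{j<n} (x + q^j)` in the expansion of `J_γ(x;a;q)`. -/
noncomputable def bigQBesselCoeff (q a γ : ℂ) (n : ℕ) : ℂ :=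
  (-1) ^ n * q ^ (n * (n - 1) / 2) / (qPoch a q n * qPoch q q n) * (a * γ) ^ n

/-- The product `∏_{j<n} (x + q^j) = x^n (-1/x;q)_n`. -/
noncomputable def shiftedProd (q x : ℂ) (n : ℕ) : ℂ := ∏ j ∈ Finset.range n, (x + q ^ j)

lemma qPoch_succ (a q : ℂ) (n : ℕ) : qPoch a q (n + 1) = qPoch a q n * (1 - a * q ^ n) :=
  Finset.prod_range_succ _ _

lemma shiftedProd_zero (q x : ℂ) : shiftedProd q x 0 = 1 :=
  Finset.prod_range_zero _

lemma shiftedProd_succ (q x : ℂ) (n : ℕ) :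
    shiftedProd q x (n + 1) = shiftedProd q x n * (x + q ^ n) :=
  Finset.prod_range_succ _ _

lemma qPoch_neg_one_div_mul_pow (q : ℂ) {x : ℂ} (hx : x ≠ 0) (n : ℕ) :
    qPoch (-1 / x) q n * x ^ n = shiftedProd q x n := by
  induction n with
  | zero => simp [qPoch, shiftedProd]
  | succ n ih =>
    rw [qPoch_succ, shiftedProd_succ, ← ih]
    field_simp
    ring

lemma bigQBessel_eq_tsum (q a γ : ℂ) {x : ℂ} (hx : x ≠ 0) :
    bigQBessel q a γ x = ∑' n, bigQBesselCoeff q a γ n * shiftedProd q x n := by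
  unfold bigQBessel bigQBesselCoeff
  refine tsum_congr fun n => ?_
  rw [← qPoch_neg_one_div_mul_pow q hx, mul_pow _ x]
  ring

/-- `P_{n+1}(qx) - P_{n+1}(x) = -(1 - q^{n+1}) x P_n(x)` for `P_n = shiftedProd q · n`. -/
lemma shiftedProd_mul_sub (q x : ℂ) (n : ℕ) :
    shiftedProd q (q * x) (n + 1) - shiftedProd q x (n + 1) =
      -(1 - q ^ (n + 1)) * x * shiftedProd q x n := by
  have h : shiftedProd q (q * x) (n + 1) = q ^ n * (q * x + 1) * shiftedProd q x n := by
    induction n with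
    | zero => simp [shiftedProd]
    | succ n ih =>
      rw [shiftedProd_succ, ih, shiftedProd_succ]
      ring
  rw [h, shiftedProd_succ]
  ring

lemma shiftedProd_inv_mul {q : ℂ} (hq : q ≠ 0) (x : ℂ) (n : ℕ) :
    q ^ n * ((x + 1) * shiftedProd q (q⁻¹ * x) n) = shiftedProd q x (n + 1) := by
  induction n with
  | zero => simp [shiftedProd]
  | succ n ih =>
    rw [shiftedProd_succ q x, ← ih, shiftedProd_succ]
    field_simp
    ring

lemma shiftedProd_qDifference {q a x : ℂ} (hq : q ≠ 0) (ha : a ≠ 0) (hx : x ≠ 0) (n : ℕ) :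
    (1 / x) * (1 + 1 / (a * x)) * (shiftedProd q (q * x) (n + 1) - shiftedProd q x (n + 1)) +
      (q / (a * x)) * (1 + 1 / x) *
        (shiftedProd q (q⁻¹ * x) (n + 1) - shiftedProd q x (n + 1)) =
      (1 - q ^ (n + 1)) * (1 - a * q ^ n) / (a * q ^ n) * shiftedProd q x n := by
  have h := shiftedProd_mul_sub q (q⁻¹ * x) n
  rw [mul_inv_cancel_left₀ hq] at h
  have h' : shiftedProd q (q⁻¹ * x) (n + 1) - shiftedProd q x (n + 1) =
      (1 - q ^ (n + 1)) * (q⁻¹ * x) * shiftedProd q (q⁻¹ * x) n := by linear_combination -h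
  have e := shiftedProd_inv_mul hq x n
  rw [shiftedProd_succ] at e
  rw [shiftedProd_mul_sub, h']
  generalize shiftedProd q (q⁻¹ * x) n = s at e ⊢
  field_simp
  linear_combination (1 - q ^ (n + 1)) * e

lemma bigQBesselCoeff_succ (q a γ : ℂ) (n : ℕ) :
    bigQBesselCoeff q a γ (n + 1) =
      -(a * γ * q ^ n) / ((1 - a * q ^ n) * (1 - q ^ (n + 1))) * bigQBesselCoeff q a γ n := by
  have h : (n + 1) * (n + 1 - 1) / 2 = n * (n - 1) / 2 + n := by
    simp only [← Nat.choose_two_right, Nat.choose_succ_succ' n 1, Nat.choose_one_right]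
    ring
  unfold bigQBesselCoeff
  rw [h, qPoch_succ, qPoch_succ, pow_succ' q n]
  simp only [div_eq_mul_inv, mul_inv]
  ring

lemma summable_bigQBesselCoeff_mul {q : ℂ} (hq : ‖q‖ < 1) (a γ x : ℂ) :
    Summable fun n => bigQBesselCoeff q a γ n * shiftedProd q x n := by
  have hp := tendsto_pow_atTop_nhds_zero_of_norm_lt_one hq
  have hp' := hp.comp (tendsto_add_atTop_nat 1)
  have hr : Tendsto (fun n => ‖-(a * γ * q ^ n) / ((1 - a * q ^ n) * (1 - q ^ (n + 1))) *
      (x + q ^ n)‖) atTop (𝓝 0) := by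
    have := ((((hp.const_mul (a * γ)).neg).div
      (((hp.const_mul a).const_sub 1).mul (hp'.const_sub 1)) (by simp)).mul
      (hp.const_add x)).norm
    simpa using this
  refine summable_of_ratio_norm_eventually_le (r := 1 / 2) (by norm_num) ?_
  filter_upwards [hr.eventually_le_const (show (0 : ℝ) < 1 / 2 by norm_num)] with n hn
  calc ‖bigQBesselCoeff q a γ (n + 1) * shiftedProd q x (n + 1)‖
      = ‖-(a * γ * q ^ n) / ((1 - a * q ^ n) * (1 - q ^ (n + 1))) * (x + q ^ n)‖ *
          ‖bigQBesselCoeff q a γ n * shiftedProd q x n‖ := by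
        rw [bigQBesselCoeff_succ, shiftedProd_succ, ← norm_mul]
        ring_nf
    _ ≤ _ := by gcongr

theorem bigQBessel_qDifference_eq (q : ℝ) (hq0 : 0 < q) (hq1 : q < 1)
    (a γ x : ℂ) (ha : a ≠ 0) (hγ : γ ≠ 0) (hx : x ≠ 0)
    (haP : ∀ n : ℕ, qPoch a (q : ℂ) n ≠ 0) :
    (1 / x) * (1 + 1 / (a * x)) *
        (bigQBessel (q : ℂ) a γ ((q : ℂ) * x) - bigQBessel (q : ℂ) a γ x) +
      ((q : ℂ) / (a * x)) * (1 + 1 / x) *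
        (bigQBessel (q : ℂ) a γ ((q : ℂ)⁻¹ * x) - bigQBessel (q : ℂ) a γ x) =
      -γ * bigQBessel (q : ℂ) a γ x := by
  have hq : (q : ℂ) ≠ 0 := by exact_mod_cast hq0.ne'
  have hqn : ‖(q : ℂ)‖ < 1 := by simpa [abs_of_pos hq0] using hq1
  have hs := summable_bigQBesselCoeff_mul hqn a γ
  rw [bigQBessel_eq_tsum _ _ _ hx, bigQBessel_eq_tsum _ _ _ (mul_ne_zero hq hx),
    bigQBessel_eq_tsum _ _ _ (mul_ne_zero (inv_ne_zero hq) hx),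
    ← (hs _).tsum_sub (hs x), ← (hs _).tsum_sub (hs x), ← tsum_mul_left, ← tsum_mul_left,
    ← tsum_mul_left]
  have h1 := ((hs (q * x)).sub (hs x)).mul_left ((1 / x) * (1 + 1 / (a * x)))
  have h2 := ((hs ((q : ℂ)⁻¹ * x)).sub (hs x)).mul_left (((q : ℂ) / (a * x)) * (1 + 1 / x))
  rw [← h1.tsum_add h2, (h1.add h2).tsum_eq_zero_add]
  simp only [shiftedProd_zero, sub_self, mul_zero, add_zero, zero_add]
  refine tsum_congr fun n => ?_
  have ha' : 1 - a * (q : ℂ) ^ n ≠ 0 := by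
    have := haP (n + 1)
    rw [qPoch_succ] at this
    exact right_ne_zero_of_mul this
  have hq' : 1 - (q : ℂ) ^ (n + 1) ≠ 0 := by
    rw [sub_ne_zero]
    exact_mod_cast (pow_lt_one₀ hq0.le hq1 n.succ_ne_zero).ne'
  have hc : bigQBesselCoeff q a γ (n + 1) *
      ((1 - (q : ℂ) ^ (n + 1)) * (1 - a * (q : ℂ) ^ n) / (a * (q : ℂ) ^ n)) =
      -γ * bigQBesselCoeff q a γ n := by
    rw [bigQBesselCoeff_succ]
    field_simp
  linear_combination bigQBesselCoeff q a γ (n + 1) * shiftedProd_qDifference hq ha hx n +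
    shiftedProd q x n * hc
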